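/- Let e : [0,∞) → ℝ be differentiable and satisfy ė(t) = −α(t) e(t) + v(t) + η(t) for all t ≥ 0, where α : [0,∞) → ℝ is continuous with α(t) ≥ φ_min > 0 for all t, v is bounded and measurable, and η is measurable with |η(t)| ≤ Δ_η for all t. Set ε = Δ_η/φ_min. Then for all t ≥ 0: ‖e(t)‖_ε ≤ e^{−φ_min t} ‖e(0)‖_ε + (1/φ_min) ‖v‖_{∞,[0,t]}. -/

import Mathlib

/-- The deadzone "norm": `‖x‖_Δ = |x| - Δ` if `|x| > Δ`, and `0` otherwise. -/
noncomputable def deadzone (Δ x : ℝ) : ℝ := if Δ < |x| then |x| - Δ else 0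

theorem dz_aux (e α w : ℝ → ℝ) (φ K D t : ℝ) (hφ : 0 < φ) (hK : 0 ≤ K) (hD : 0 ≤ D)
    (hαb : ∀ s ≥ (0:ℝ), φ ≤ α s) (hw : ∀ s ∈ Set.Icc 0 t, w s < K)
    (hed : ∀ s ≥ (0:ℝ), HasDerivWithinAt e (-(α s) * e s + w s) (Set.Ici 0) s)
    (h0 : e 0 ≤ D + K / φ) (ht : 0 ≤ t) :
    e t ≤ D * Real.exp (-φ * t) + K / φ := by
  have hB : ∀ x, HasDerivAt (fun s => D * Real.exp (-φ * s) + K / φ)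
      (D * (Real.exp (-φ * x) * (-φ * 1))) x := fun x =>
    ((((hasDerivAt_id x).const_mul (-φ)).exp).const_mul D).add_const (K / φ)
  refine image_le_of_deriv_right_lt_deriv_boundary (a := 0) (b := t) (f := e)
    (f' := fun s => -(α s) * e s + w s) (B := fun s => D * Real.exp (-φ * s) + K / φ)
    ?_ ?_ ?_ hB ?_ (Set.right_mem_Icc.2 ht)
  · intro s hs
    exact (hed s hs.1).continuousWithinAt.mono (fun x hx => hx.1)
  · intro s hs
    exact (hed s hs.1).mono (Set.Ici_subset_Ici.2 hs.1)
  · simpa using h0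
  · intro s hs h
    have h1 := hw s ⟨hs.1, hs.2.le⟩
    have h2 := hαb s hs.1
    have h3 : 0 ≤ D * Real.exp (-φ * s) := by positivity
    have h4 : 0 ≤ K / φ := by positivity
    have h5 : φ * (K / φ) = K := by field_simp
    have h6 : φ * e s ≤ α s * e s := mul_le_mul_of_nonneg_right h2 (by rw [h]; positivity)
    have h7 : φ * e s = φ * (D * Real.exp (-φ * s)) + K := by rw [h, mul_add, h5]
    nlinarith

/-- Deadzone estimate (eq. (23)) from Step 1 of the proof of Theorem 1:
if `ė = -α(t) e + v(t) + η(t)` on `[0,∞)` with `α` continuous, `α(t) ≥ φ_min > 0`,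
`v` bounded measurable, `|η(t)| ≤ Δ_η`, and `ε = Δ_η/φ_min`, then
`‖e(t)‖_ε ≤ e^{-φ_min t} ‖e(0)‖_ε + (1/φ_min)‖v‖_{∞,[0,t]}`. -/
theorem deadzone_estimate
    (e α v η : ℝ → ℝ) (φmin Δη : ℝ) (hφ : 0 < φmin)
    (hαc : ContinuousOn α (Set.Ici 0))
    (hαb : ∀ t ≥ (0:ℝ), φmin ≤ α t)
    (hvm : Measurable v) (hvb : ∃ V : ℝ, ∀ t ≥ (0:ℝ), |v t| ≤ V)
    (hηm : Measurable η) (hηb : ∀ t ≥ (0:ℝ), |η t| ≤ Δη)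
    (hed : ∀ t ≥ (0:ℝ), HasDerivWithinAt e (-(α t) * e t + v t + η t) (Set.Ici 0) t) :
    ∀ t ≥ (0:ℝ),
      deadzone (Δη / φmin) (e t) ≤
        Real.exp (-φmin * t) * deadzone (Δη / φmin) (e 0) +
          (1 / φmin) * sSup ((fun τ => |v τ|) '' Set.Icc 0 t) := by
  intro t ht
  obtain ⟨V, hV⟩ := hvb
  have hΔ : 0 ≤ Δη := (abs_nonneg _).trans (hηb 0 le_rfl)
  have hle : ∀ s ∈ Set.Icc 0 t, |v s| ≤ sSup ((fun τ => |v τ|) '' Set.Icc 0 t) := by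
    intro s hs
    refine le_csSup ⟨V, ?_⟩ ⟨s, hs, rfl⟩
    rintro _ ⟨x, hx, rfl⟩
    exact hV x hx.1
  set M := sSup ((fun τ => |v τ|) '' Set.Icc 0 t) with hM
  have hM0 : 0 ≤ M := (abs_nonneg _).trans (hle 0 ⟨le_rfl, ht⟩)
  set D := deadzone (Δη / φmin) (e 0) with hDd
  have hD : 0 ≤ D := by
    rw [hDd]; unfold deadzone; split_ifs with h <;> linarith
  have hD' : |e 0| ≤ D + Δη / φmin := by
    rw [hDd]; unfold deadzone; split_ifs with h <;> linarith
  have key : |e t| ≤ D * Real.exp (-φmin * t) + (Δη + M) / φmin := by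
    refine le_of_forall_pos_le_add fun δ hδ => ?_
    have hp : 0 < δ * φmin := by positivity
    have hs : (Δη + M + δ * φmin) / φmin = (Δη + M) / φmin + δ := by field_simp
    have hs2 : (Δη + M) / φmin = Δη / φmin + M / φmin := by ring
    have hq : 0 ≤ M / φmin := by positivity
    have h1 := dz_aux e α (fun s => v s + η s) φmin (Δη + M + δ * φmin) D t hφ (by positivity) hD
      hαb (fun s hs => by
        have := (abs_le.1 (hle s hs)).2
        have := (abs_le.1 (hηb s hs.1)).2
        linarith)
      (fun s hs => (hed s hs).congr_deriv (by ring))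
      (by have := (abs_le.1 hD').2; linarith) ht
    have h2 := dz_aux (fun s => - e s) α (fun s => - (v s + η s)) φmin (Δη + M + δ * φmin) D t hφ
      (by positivity) hD
      hαb (fun s hs => by
        have := (abs_le.1 (hle s hs)).1
        have := (abs_le.1 (hηb s hs.1)).1
        linarith)
      (fun s hs => (hed s hs).fun_neg.congr_deriv (by ring))
      (by have := (abs_le.1 hD').1; linarith) ht
    rw [abs_le]
    constructor <;> linarith
  have hs2 : (Δη + M) / φmin = Δη / φmin + 1 / φmin * M := by ring
  have hq : 0 ≤ 1 / φmin * M := by positivity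
  have hr : 0 ≤ Real.exp (-φmin * t) * D := by positivity
  unfold deadzone
  split_ifs with h <;> linarith
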